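/- arXiv:1305.7297 — 3 statements merged into one kernel-verified Lean document; each statement's English description precedes it below -/
import Mathlib

section
/- Let F : ℝ⁵ → ℝ be a smooth function of the coordinates (x, y, y₁, y₂, z) on an open set U ⊆ ℝ⁵, and let X₁ = ∂/∂y₂ and X₂ = ∂/∂x + y₁ ∂/∂y + y₂ ∂/∂y₁ + F ∂/∂z be the vector fields spanning the Monge distribution of z' = F(x, y, y', y'', z). If at a point p ∈ U the second partial derivative ∂²F/∂y₂²(p) is nonzero, then the five vectors X₁(p), X₂(p), [X₁,X₂](p), [X₁,[X₁,X₂]](p), [X₂,[X₁,X₂]](p) are linearly independent, i.e., form a basis of ℝ⁵. -/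
/-- Lie bracket of vector fields on ℝ⁵, `[V,W](p) = DW(p)(V(p)) − DV(p)(W(p))`. -/
noncomputable def lieBracket (V W : (Fin 5 → ℝ) → (Fin 5 → ℝ)) :
    (Fin 5 → ℝ) → (Fin 5 → ℝ) :=
  fun p => fderiv ℝ W p (V p) - fderiv ℝ V p (W p)

/-- Standard basis vector `∂/∂(coordinate i)`. -/
noncomputable def e (i : Fin 5) : Fin 5 → ℝ := Pi.single i 1

/-- `X₁ = ∂/∂y₂`, coordinates `(x, y, y₁, y₂, z) = (p 0, p 1, p 2, p 3, p 4)`. -/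
noncomputable def X₁ : (Fin 5 → ℝ) → (Fin 5 → ℝ) := fun _ => ![0, 0, 0, 1, 0]

/-- `X₂ = ∂/∂x + y₁ ∂/∂y + y₂ ∂/∂y₁ + F ∂/∂z`. -/
noncomputable def X₂ (F : (Fin 5 → ℝ) → ℝ) : (Fin 5 → ℝ) → (Fin 5 → ℝ) :=
  fun p => ![1, p 2, p 3, 0, F p]

theorem fderiv_X₂_apply {F : (Fin 5 → ℝ) → ℝ} {q : Fin 5 → ℝ} (hF : DifferentiableAt ℝ F q)
    (v : Fin 5 → ℝ) : fderiv ℝ (X₂ F) q v = ![0, v 2, v 3, 0, fderiv ℝ F q v] := by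
  have hd : ∀ i, DifferentiableAt ℝ (fun p => X₂ F p i) q := by
    intro i
    fin_cases i <;> simp [X₂] <;> first | exact hF | fun_prop
  ext i
  rw [fderiv_pi hd]
  fin_cases i <;> simp [X₂, fderiv_apply]

theorem fderiv_X₃_apply {G : (Fin 5 → ℝ) → ℝ} {q : Fin 5 → ℝ} (hG : DifferentiableAt ℝ G q)
    (v : Fin 5 → ℝ) :
    fderiv ℝ (fun p => (![0, 0, 1, 0, G p] : Fin 5 → ℝ)) q v
      = ![0, 0, 0, 0, fderiv ℝ G q v] := by
  have hd : ∀ i, DifferentiableAt ℝ (fun p => (![0, 0, 1, 0, G p] : Fin 5 → ℝ) i) q := by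
    intro i
    fin_cases i <;> simp <;> exact hG
  ext i
  rw [fderiv_pi hd]
  fin_cases i <;> simp

theorem fderiv_X₁ (q : Fin 5 → ℝ) : fderiv ℝ X₁ q = 0 := by
  unfold X₁
  simp

theorem X₁_eq (q : Fin 5 → ℝ) : X₁ q = e 3 := by
  ext i
  fin_cases i <;> simp [X₁, e, Pi.single_apply]

theorem monge_generic_of_d2F_ne_zero
    (U : Set (Fin 5 → ℝ)) (hU : IsOpen U)
    (F : (Fin 5 → ℝ) → ℝ) (hF : ContDiffOn ℝ (⊤ : ℕ∞) F U)
    (p : Fin 5 → ℝ) (hp : p ∈ U)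
    (hF2 : fderiv ℝ (fun q => fderiv ℝ F q (e 3)) p (e 3) ≠ 0) :
    LinearIndependent ℝ
      ![X₁ p, X₂ F p, lieBracket X₁ (X₂ F) p,
        lieBracket X₁ (lieBracket X₁ (X₂ F)) p,
        lieBracket (X₂ F) (lieBracket X₁ (X₂ F)) p] := by
  have hFat : ∀ q ∈ U, ContDiffAt ℝ (⊤ : ℕ∞) F q := fun q hq => hF.contDiffAt (hU.mem_nhds hq)
  have hFd : ∀ q ∈ U, DifferentiableAt ℝ F q := fun q hq =>
    (hFat q hq).differentiableAt (by simp)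
  have hG : DifferentiableAt ℝ (fun q => fderiv ℝ F q (e 3)) p := by
    have h1 : ContDiffAt ℝ 1 (fderiv ℝ F) p :=
      (hFat p hp).fderiv_right (WithTop.coe_le_coe.2 (le_top : ((2 : ℕ∞)) ≤ ⊤))
    exact (h1.differentiableAt (by simp)).clm_apply (differentiableAt_const _)
  have h3 : ∀ q ∈ U, lieBracket X₁ (X₂ F) q = ![0, 0, 1, 0, fderiv ℝ F q (e 3)] := by
    intro q hq
    simp only [lieBracket, fderiv_X₁, fderiv_X₂_apply (hFd q hq), X₁_eq]
    ext i
    fin_cases i <;> simp [e, Pi.single_apply]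
  have h3' : lieBracket X₁ (X₂ F) =ᶠ[nhds p]
      (fun q => (![0, 0, 1, 0, fderiv ℝ F q (e 3)] : Fin 5 → ℝ)) :=
    Filter.eventually_of_mem (hU.mem_nhds hp) h3
  have h4 : lieBracket X₁ (lieBracket X₁ (X₂ F)) p
      = ![0, 0, 0, 0, fderiv ℝ (fun q => fderiv ℝ F q (e 3)) p (e 3)] := by
    rw [lieBracket, h3'.fderiv_eq, fderiv_X₃_apply hG, fderiv_X₁, X₁_eq]
    simp
  obtain ⟨c, h5⟩ : ∃ c, lieBracket (X₂ F) (lieBracket X₁ (X₂ F)) p = ![0, -1, 0, 0, c] := by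
    rw [lieBracket, h3'.fderiv_eq, fderiv_X₃_apply hG, h3 p hp, fderiv_X₂_apply (hFd p hp)]
    simp
  rw [h4, h5, h3 p hp]
  generalize fderiv ℝ (fun q => fderiv ℝ F q (e 3)) p (e 3) = a at *
  rw [Fintype.linearIndependent_iff]
  intro g hg
  have k := fun i => congrFun hg i
  have k0 := k 0
  have k1 := k 1
  have k2 := k 2
  have k3 := k 3
  have k4 := k 4
  simp [Fin.sum_univ_five, X₁, X₂] at k0 k1 k2 k3 k4
  have g1 : g 1 = 0 := k0
  have g3 : g 0 = 0 := k3
  have g2 : g 2 = 0 := by simpa [g1] using k2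
  have g4 : g 4 = 0 := by simpa [g1] using k1
  have g5 : g 3 = 0 := by simpa [g1, g2, g4, hF2] using k4
  intro i
  fin_cases i <;> assumption
end

section
/- The vector fields S₁ = x ∂/∂y + ∂/∂y₁ + (1/2)x² ∂/∂z, S₂ = x ∂/∂x − y ∂/∂y − 2y₁ ∂/∂y₁ − 3y₂ ∂/∂y₂, S₃ = y ∂/∂x − y₁² ∂/∂y₁ − 3y₁y₂ ∂/∂y₂ + (1/2)y² ∂/∂z on ℝ⁵ satisfy the sl(2) commutation relations: [S₂, S₁] = 2S₁, [S₂, S₃] = −2S₃, and [S₁, S₃] = S₂. -/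
/-- `S₁ = x ∂/∂y + ∂/∂y₁ + (1/2)x² ∂/∂z`, coordinates
`(x, y, y₁, y₂, z) = (p 0, p 1, p 2, p 3, p 4)`. -/
noncomputable def S₁ : (Fin 5 → ℝ) → (Fin 5 → ℝ) :=
  fun p => ![0, p 0, 1, 0, (1 / 2) * (p 0) ^ 2]

/-- `S₂ = x ∂/∂x − y ∂/∂y − 2y₁ ∂/∂y₁ − 3y₂ ∂/∂y₂`. -/
noncomputable def S₂ : (Fin 5 → ℝ) → (Fin 5 → ℝ) :=
  fun p => ![p 0, -p 1, -2 * p 2, -3 * p 3, 0]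

/-- `S₃ = y ∂/∂x − y₁² ∂/∂y₁ − 3y₁y₂ ∂/∂y₂ + (1/2)y² ∂/∂z`. -/
noncomputable def S₃ : (Fin 5 → ℝ) → (Fin 5 → ℝ) :=
  fun p => ![p 1, 0, -(p 2) ^ 2, -3 * p 2 * p 3, (1 / 2) * (p 1) ^ 2]

/-- `S₄ = ∂/∂x`. -/
noncomputable def S₄ : (Fin 5 → ℝ) → (Fin 5 → ℝ) := fun _ => ![1, 0, 0, 0, 0]

/-- `S₅ = ∂/∂y + x ∂/∂z`. -/
noncomputable def S₅ : (Fin 5 → ℝ) → (Fin 5 → ℝ) := fun p => ![0, 1, 0, 0, p 0]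

/-- `S₆ = ∂/∂z`. -/
noncomputable def S₆ : (Fin 5 → ℝ) → (Fin 5 → ℝ) := fun _ => ![0, 0, 0, 0, 1]

/-- A smooth field's derivative along `v` is computed componentwise along the line `p + t v`. -/
lemma fderiv_of_line {F : (Fin 5 → ℝ) → (Fin 5 → ℝ)} (hF : Differentiable ℝ F)
    (p v w : Fin 5 → ℝ)
    (h : ∀ i, HasDerivAt (fun t : ℝ => F (p + t • v) i) (w i) 0) :
    fderiv ℝ F p v = w := by
  rw [← (hF p).lineDeriv_eq_fderiv]
  exact (hasDerivAt_pi.2 h).deriv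

lemma line_coord (p v : Fin 5 → ℝ) (i : Fin 5) :
    HasDerivAt (fun t : ℝ => p i + t * v i) (v i) 0 := by
  simpa using ((hasDerivAt_id (0 : ℝ)).mul_const (v i)).const_add (p i)

lemma fderiv_S₁ (p v : Fin 5 → ℝ) : fderiv ℝ S₁ p v = ![0, v 0, 0, 0, p 0 * v 0] := by
  refine fderiv_of_line ?_ p v _ ?_
  · refine differentiable_pi.2 fun i => ?_
    fin_cases i <;> simp [S₁] <;> fun_prop
  · intro i
    fin_cases i
    · exact hasDerivAt_const _ _
    · exact line_coord p v 0
    · exact hasDerivAt_const _ _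
    · exact hasDerivAt_const _ _
    · refine HasDerivAt.congr_deriv (((line_coord p v 0).pow 2).const_mul (1 / 2 : ℝ)) ?_
      simp <;> ring

lemma fderiv_S₂ (p v : Fin 5 → ℝ) :
    fderiv ℝ S₂ p v = ![v 0, -v 1, -2 * v 2, -3 * v 3, 0] := by
  refine fderiv_of_line ?_ p v _ ?_
  · refine differentiable_pi.2 fun i => ?_
    fin_cases i <;> simp [S₂] <;> fun_prop
  · intro i
    fin_cases i
    · exact line_coord p v 0
    · exact (line_coord p v 1).neg
    · exact (line_coord p v 2).const_mul (-2)
    · exact (line_coord p v 3).const_mul (-3)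
    · exact hasDerivAt_const _ _

lemma fderiv_S₃ (p v : Fin 5 → ℝ) :
    fderiv ℝ S₃ p v =
      ![v 1, 0, -(2 * p 2 * v 2), -3 * v 2 * p 3 + -3 * p 2 * v 3, p 1 * v 1] := by
  refine fderiv_of_line ?_ p v _ ?_
  · refine differentiable_pi.2 fun i => ?_
    fin_cases i <;> simp [S₃] <;> fun_prop
  · intro i
    fin_cases i
    · exact line_coord p v 1
    · exact hasDerivAt_const _ _
    · refine HasDerivAt.congr_deriv (((line_coord p v 2).pow 2).neg) ?_
      simp <;> ring
    · refine HasDerivAt.congr_deriv (((line_coord p v 2).const_mul (-3)).mul (line_coord p v 3)) ?_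
      simp <;> ring
    · refine HasDerivAt.congr_deriv (((line_coord p v 1).pow 2).const_mul (1 / 2 : ℝ)) ?_
      simp <;> ring

/-- `S₁, S₂, S₃` satisfy the `sl(2)` commutation relations:
`[S₂,S₁] = 2S₁`, `[S₂,S₃] = −2S₃`, `[S₁,S₃] = S₂`. -/
theorem sl2_relations :
    lieBracket S₂ S₁ = (2 : ℝ) • S₁ ∧
    lieBracket S₂ S₃ = (-2 : ℝ) • S₃ ∧
    lieBracket S₁ S₃ = S₂ := by
  refine ⟨?_, ?_, ?_⟩ <;> funext p i <;>
    simp only [lieBracket, fderiv_S₁, fderiv_S₂, fderiv_S₃] <;>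
    fin_cases i <;> simp [S₁, S₂, S₃] <;> ring
end

section
/- Let π : ℝ⁵ → ℝ⁴ be the projection π(x, y, y₁, y₂, z) = (x, y, y₁, y₂), and let S₁,…,S₆ be the vector fields on ℝ⁵ given by S₁ = x ∂/∂y + ∂/∂y₁ + (1/2)x² ∂/∂z, S₂ = x ∂/∂x − y ∂/∂y − 2y₁ ∂/∂y₁ − 3y₂ ∂/∂y₂, S₃ = y ∂/∂x − y₁² ∂/∂y₁ − 3y₁y₂ ∂/∂y₂ + (1/2)y² ∂/∂z, S₄ = ∂/∂x, S₅ = ∂/∂y + x ∂/∂z, S₆ = ∂/∂z. For c₁,…,c₆ ∈ ℝ, the combination S = c₁S₁ + … + c₆S₆ satisfies Dπ(p)(S(p)) = 0 for all p ∈ ℝ⁵ if and only if c₁ = c₂ = c₃ = c₄ = c₅ = 0. In other words, the kernel of the projection π∗ restricted to span{S₁,…,S₆} is exactly the line spanned by S₆. -/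
/-- The projection `π(x, y, y₁, y₂, z) = (x, y, y₁, y₂)`. -/
noncomputable def proj : (Fin 5 → ℝ) → (Fin 4 → ℝ) := fun p i => p i.castSucc

/-- The kernel of `π∗` restricted to `span{S₁, …, S₆}` is exactly the line spanned
by `S₆`: the combination `c₁S₁ + … + c₆S₆` projects to zero iff `c₁ = … = c₅ = 0`. -/
theorem kernel_of_projection (c₁ c₂ c₃ c₄ c₅ c₆ : ℝ) :
    (∀ p : Fin 5 → ℝ,
        fderiv ℝ proj p
          (c₁ • S₁ p + c₂ • S₂ p + c₃ • S₃ p + c₄ • S₄ p + c₅ • S₅ p + c₆ • S₆ p) = 0)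
      ↔ (c₁ = 0 ∧ c₂ = 0 ∧ c₃ = 0 ∧ c₄ = 0 ∧ c₅ = 0) := by
  have hd : ∀ p v : Fin 5 → ℝ, fderiv ℝ proj p v = proj v := by
    intro p v
    let L : (Fin 5 → ℝ) →L[ℝ] (Fin 4 → ℝ) :=
      ContinuousLinearMap.pi fun i : Fin 4 => ContinuousLinearMap.proj i.castSucc
    have hL : proj = L := rfl
    rw [hL, L.fderiv]
  simp only [hd]
  constructor
  · intro h
    have a0 := congrFun (h 0) 0
    have a1 := congrFun (h 0) 1
    have a2 := congrFun (h 0) 2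
    have b0 := congrFun (h ![1, 0, 0, 0, 0]) 0
    have d0 := congrFun (h ![0, 1, 0, 0, 0]) 0
    simp [proj, S₁, S₂, S₃, S₄, S₅, S₆] at a0 a1 a2 b0 d0
    refine ⟨?_, ?_, ?_, ?_, ?_⟩ <;> linarith
  · rintro ⟨rfl, rfl, rfl, rfl, rfl⟩ p
    ext i
    fin_cases i <;> simp [proj, S₆]
end
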